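/- For every prime p ≤ 436273009, the gap to the next prime satisfies g(p) < (p + 1)/log p. -/

import Mathlib

/-- Proth's primality criterion for `p = k * 2 ^ (n + 1) + 1`: it suffices that
`w ^ ((p - 1) / 2) = -1` modulo `p`. -/
theorem Nat.Prime.of_pow_eq_neg_one {k n w : ℕ} (hk : 0 < k) (hkn : k ≤ 2 ^ (n + 1))
    (hw : (w : ZMod (k * 2 ^ (n + 1) + 1)) ^ (k * 2 ^ n) = -1) :
    (k * 2 ^ (n + 1) + 1).Prime := by
  set p := k * 2 ^ (n + 1) + 1 with hp
  have hpos : 0 < 2 ^ n := by positivity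
  have hpow : 2 ^ (n + 1) = 2 * 2 ^ n := by ring
  have hkpos : 0 < k * 2 ^ n := by positivity
  have hp2 : 2 < p := by rw [hp, hpow]; nlinarith
  by_contra hnp
  have hr : p.minFac.Prime := Nat.minFac_prime (by omega)
  have hle : p.minFac ^ 2 ≤ p := Nat.minFac_sq_le_self (by omega) hnp
  have hdvd : p.minFac ∣ p := Nat.minFac_dvd p
  set r := p.minFac
  have : Fact r.Prime := ⟨hr⟩
  have hr2 : r ≠ 2 := by
    intro h
    rw [h, hp, hpow] at hdvd
    have : 2 ∣ k * (2 * 2 ^ n) := ⟨k * 2 ^ n, by ring⟩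
    omega
  have : Fact (2 < r) := ⟨by have := hr.two_le; omega⟩
  have hwr : (w : ZMod r) ^ (k * 2 ^ n) = -1 := by
    have h := congrArg (ZMod.castHom hdvd (ZMod r)) hw
    rwa [map_pow, map_natCast, map_neg, map_one] at h
  have hx1 : ¬ ((w : ZMod r) ^ k) ^ 2 ^ n = 1 := by
    rw [← pow_mul, hwr]
    exact ZMod.neg_one_ne_one
  have hx2 : ((w : ZMod r) ^ k) ^ 2 ^ (n + 1) = 1 := by
    rw [pow_succ, pow_mul, ← pow_mul (w : ZMod r), hwr]
    norm_num
  have hord := orderOf_eq_prime_pow hx1 hx2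
  have hx0 : (w : ZMod r) ^ k ≠ 0 := by
    intro h
    rw [h, zero_pow (by positivity)] at hx2
    exact zero_ne_one hx2
  have hlt := Nat.le_of_dvd (by have := hr.two_le; omega)
    (hord ▸ ZMod.orderOf_dvd_card_sub_one hx0)
  have : 2 ^ (n + 1) + 1 ≤ r := by have := hr.two_le; omega
  nlinarith

/-- The residue of `x ^ 2 ^ n` modulo `p`, computed by repeated squaring. -/
def iterSqMod (p : ℕ) : ℕ → ℕ → ℕ
  | 0, x => x
  | n + 1, x => iterSqMod p n (x * x % p)

theorem cast_iterSqMod (p n x : ℕ) : (iterSqMod p n x : ZMod p) = (x : ZMod p) ^ 2 ^ n := by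
  induction n generalizing x with
  | zero => simp [iterSqMod]
  | succ n ih => rw [iterSqMod, ih, ZMod.natCast_mod, Nat.cast_mul, ← sq, ← pow_mul, pow_succ']

/-- The triple `(k, n, w)` satisfies Proth's criterion for `k * 2 ^ n + 1` with witness `w`. -/
def IsProthTriple (t : ℕ × ℕ × ℕ) : Prop :=
  0 < t.1 ∧ 0 < t.2.1 ∧ t.1 ≤ 2 ^ t.2.1 ∧
    iterSqMod (t.1 * 2 ^ t.2.1 + 1) (t.2.1 - 1) (t.2.2 ^ t.1 % (t.1 * 2 ^ t.2.1 + 1)) =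
      t.1 * 2 ^ t.2.1

instance : DecidablePred IsProthTriple := fun t => by
  unfold IsProthTriple; infer_instance

theorem IsProthTriple.prime {t : ℕ × ℕ × ℕ} (h : IsProthTriple t) :
    (t.1 * 2 ^ t.2.1 + 1).Prime := by
  obtain ⟨k, n, w⟩ := t
  obtain ⟨hk, hn, hkn, hw⟩ := h
  obtain ⟨n, rfl⟩ := Nat.exists_eq_add_of_lt hn
  simp only [zero_add, Nat.add_sub_cancel] at hk hkn hw ⊢
  refine Nat.Prime.of_pow_eq_neg_one (w := w) hk hkn ?_
  have h := congrArg (Nat.cast (R := ZMod (k * 2 ^ (n + 1) + 1))) hw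
  rw [cast_iterSqMod, ZMod.natCast_mod, Nat.cast_pow, ← pow_mul] at h
  rw [h, eq_neg_iff_add_eq_zero, ← Nat.cast_add_one, ZMod.natCast_self]

theorem Real.log_le_mul_add_div_two_pow {x : ℝ} (hx : 0 < x) (m : ℕ) :
    Real.log x ≤ m * 0.69315 + (x / 2 ^ m - 1) := by
  have h1 := Real.log_le_sub_one_of_pos (show 0 < x / 2 ^ m by positivity)
  rw [Real.log_div hx.ne' (by positivity), Real.log_pow] at h1
  have h2 : (m : ℝ) * Real.log 2 ≤ m * 0.69315 := by
    gcongr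
    linarith [Real.log_two_lt_d9]
  linarith

/-- An arithmetic condition guaranteeing `(b - p) * log p < p + 1` for all `p` in `[a, b)`. The
logarithm is estimated by its tangent at the power of two closest to `a` on a logarithmic scale. -/
def GapCondition (a b : ℕ) : Prop :=
  let m := Nat.log2 (4 * a / 3)
  b - a ≤ 2 ^ m ∧
    (b - a) * (m * 69315 * 2 ^ m + 100000 * a) <
      100000 * 2 ^ m * (a + 1) + (b - a) * (100000 * 2 ^ m)

instance (a b : ℕ) : Decidable (GapCondition a b) := by
  unfold GapCondition; infer_instance

theorem GapCondition.mul_log_lt {a b p : ℕ} (h : GapCondition a b) (ha : 0 < a) (hap : a ≤ p)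
    (hpb : p < b) : ((b : ℝ) - p) * Real.log p < p + 1 := by
  obtain ⟨h1, h2⟩ := h
  set m := Nat.log2 (4 * a / 3)
  have hab : a ≤ b := by omega
  obtain ⟨d, rfl⟩ := Nat.exists_eq_add_of_le hab
  obtain ⟨e, rfl⟩ := Nat.exists_eq_add_of_le hap
  rw [Nat.add_sub_cancel_left] at h1 h2
  have ha' : (0 : ℝ) < a := by exact_mod_cast ha
  have hlog := Real.log_le_mul_add_div_two_pow (x := ((a + e : ℕ) : ℝ)) (by positivity) m
  have hlog0 : 0 ≤ Real.log ((a + e : ℕ) : ℝ) := Real.log_natCast_nonneg _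
  have h1' : (d : ℝ) ≤ 2 ^ m := by exact_mod_cast h1
  have h2' : (d : ℝ) * (m * 69315 * 2 ^ m + 100000 * a) <
      100000 * 2 ^ m * (a + 1) + d * (100000 * 2 ^ m) := by exact_mod_cast h2
  have hM : (0 : ℝ) < 2 ^ m := by positivity
  have hd0 : (0 : ℝ) ≤ d := by positivity
  have he0 : (0 : ℝ) ≤ e := by positivity
  push_cast at hlog hlog0 ⊢
  have hstart : (d : ℝ) * (m * 0.69315 + (a / 2 ^ m - 1)) < a + 1 := by
    rw [← mul_lt_mul_iff_left₀ hM]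
    have : (d : ℝ) * (m * 0.69315 + (a / 2 ^ m - 1)) * 2 ^ m =
        d * (m * 0.69315 * 2 ^ m + (a - 2 ^ m)) := by field_simp
    rw [this]
    linarith
  have hslope : (d : ℝ) * (e / 2 ^ m) ≤ e := by
    rw [← mul_div_assoc, div_le_iff₀ hM]
    nlinarith
  calc ((a : ℝ) + d - (a + e)) * Real.log (a + e)
      ≤ d * Real.log (a + e) := by gcongr; linarith
    _ ≤ d * (m * 0.69315 + ((a + e) / 2 ^ m - 1)) := by gcongr
    _ = d * (m * 0.69315 + (a / 2 ^ m - 1)) + d * (e / 2 ^ m) := by ring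
    _ < a + e + 1 := by linarith

/-- A chain of primes with small gaps gives `(q - p) * log p < p + 1` for consecutive primes
`p < q` in its range. -/
theorem sub_mul_log_lt_of_isChain {a p q : ℕ} {l : List ℕ} (hchain : (a :: l).IsChain GapCondition)
    (ha : 0 < a) (hprime : ∀ r ∈ l, r.Prime) (hap : a ≤ p)
    (hp : p < (a :: l).getLast (List.cons_ne_nil a l))
    (hnext : ∀ r, r.Prime → p < r → q ≤ r) : ((q : ℝ) - p) * Real.log p < p + 1 := by
  induction l generalizing a with
  | nil => simp at hp; omega
  | cons b l ih =>
    rw [List.isChain_cons_cons] at hchain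
    have hb := hprime b List.mem_cons_self
    rcases lt_or_ge p b with hpb | hpb
    · have hqb : (q : ℝ) ≤ b := by exact_mod_cast hnext b hb hpb
      refine lt_of_le_of_lt ?_ (hchain.1.mul_log_lt ha hap hpb)
      have := Real.log_natCast_nonneg p
      gcongr
    · exact ih hchain.2 hb.pos (fun r hr => hprime r (List.mem_cons_of_mem b hr)) hpb
        (by rwa [List.getLast_cons (List.cons_ne_nil b l)] at hp)

/-- Primes from `3` to `118543` with small gaps. -/
def smallPrimeLadder : List ℕ :=
  [3, 5, 7, 11, 13, 17, 23, 29, 37, 47, 59, 73, 89, 107, 127, 151, 181, 211, 241, 283, 331, 383,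
   443, 509, 587, 677, 773, 887, 1013, 1153, 1307, 1487, 1669, 1889, 2137, 2411, 2719, 3061,
   3433, 3853, 4297, 4801, 5351, 5953, 6619, 7369, 8191, 9091, 10079, 11161, 12347, 13649, 15077,
   16633, 18341, 20201, 22229, 24421, 26813, 29437, 32261, 35363, 38737, 42397, 46351, 50627,
   55259, 60293, 65761, 71671, 78079, 84991, 92431, 100459, 109147, 118543]

/-- Proth triples whose primes continue `smallPrimeLadder` beyond `436273009`. -/
def prothLadder : List (ℕ × ℕ × ℕ) :=
  [(245, 9, 3), (261, 9, 5), (281, 9, 3), (303, 9, 5), (5, 15, 3), (345, 9, 7), (23, 13, 3),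
   (99, 11, 5), (423, 9, 5), (455, 9, 3), (491, 9, 3), (33, 13, 5), (35, 13, 3), (75, 12, 7),
   (161, 11, 3), (337, 10, 3), (179, 11, 3), (385, 10, 3), (51, 13, 5), (105, 12, 13),
   (445, 10, 3), (231, 11, 13), (487, 10, 3), (261, 11, 11), (559, 10, 3), (579, 10, 5),
   (609, 10, 5), (163, 12, 3), (699, 10, 5), (187, 12, 3), (399, 11, 5), (855, 10, 7),
   (909, 10, 5), (243, 12, 7), (521, 11, 3), (69, 14, 5), (591, 11, 7), (629, 11, 3),
   (21, 16, 5), (355, 12, 3), (755, 11, 3), (807, 11, 5), (855, 11, 7), (911, 11, 3),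
   (243, 13, 5), (1037, 11, 3), (1101, 11, 17), (583, 12, 3), (621, 12, 5), (663, 12, 7),
   (351, 13, 5), (1491, 11, 11), (1581, 11, 11), (843, 12, 11), (1785, 11, 11), (1901, 11, 3),
   (1011, 12, 5), (533, 13, 3), (1131, 12, 5), (599, 13, 3), (1275, 12, 11), (1347, 12, 5),
   (179, 15, 3), (761, 13, 3), (403, 14, 3), (849, 13, 7), (1797, 12, 5), (477, 14, 7),
   (2023, 12, 3), (2137, 12, 3), (2251, 12, 3), (597, 14, 17), (2535, 12, 11), (2685, 12, 7),
   (1425, 13, 17), (1509, 13, 11), (399, 15, 5), (843, 14, 5), (3567, 12, 5), (1889, 13, 3),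
   (125, 17, 3), (265, 16, 3), (1123, 14, 3), (1185, 14, 11), (313, 16, 3), (1323, 14, 5),
   (2795, 13, 3), (1477, 14, 3), (3123, 13, 5), (3305, 13, 3), (1743, 14, 5), (1843, 14, 3),
   (487, 16, 3), (4115, 13, 3), (4331, 13, 3), (571, 16, 3), (4823, 13, 3), (637, 16, 3),
   (673, 16, 3), (5681, 13, 3), (375, 17, 7), (3153, 14, 5), (1661, 15, 3), (7005, 13, 11),
   (7391, 13, 3), (975, 16, 7), (513, 17, 5), (4327, 14, 3), (285, 18, 7), (4795, 14, 3),
   (2529, 15, 5), (333, 18, 5), (5617, 14, 3), (5889, 14, 5), (97, 20, 3), (409, 18, 3),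
   (6895, 14, 3), (7263, 14, 5), (7645, 14, 3), (2013, 16, 13), (8449, 14, 3), (8899, 14, 3),
   (9367, 14, 3), (9855, 14, 11), (5187, 15, 5), (1365, 17, 11), (11493, 14, 5), (6045, 15, 7),
   (12709, 14, 3), (13365, 14, 13), (14029, 14, 3), (14757, 14, 7), (485, 19, 3),
   (16317, 14, 11), (8565, 15, 7), (4501, 16, 3), (2361, 17, 5), (9917, 15, 3), (5205, 16, 11),
   (5467, 16, 3), (2871, 17, 5), (6027, 16, 5), (12645, 15, 11), (13277, 15, 3), (6963, 16, 17)]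

/-- Primes above `2`, with small gaps, reaching beyond `436273009`. -/
def primeLadder : List ℕ :=
  smallPrimeLadder ++ prothLadder.map fun t => t.1 * 2 ^ t.2.1 + 1

theorem prime_of_mem_smallPrimeLadder : ∀ r ∈ smallPrimeLadder, r.Prime := by
  simp only [smallPrimeLadder, List.forall_mem_cons]
  norm_num

theorem isProthTriple_of_mem_prothLadder : ∀ t ∈ prothLadder, IsProthTriple t := by
  decide +kernel

theorem prime_of_mem_primeLadder {r : ℕ} (hr : r ∈ primeLadder) : r.Prime := by
  rcases List.mem_append.1 hr with hr | hr
  · exact prime_of_mem_smallPrimeLadder r hr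
  · obtain ⟨t, ht, rfl⟩ := List.mem_map.1 hr
    exact (isProthTriple_of_mem_prothLadder t ht).prime

theorem isChain_primeLadder : (2 :: primeLadder).IsChain GapCondition := by
  decide +kernel

theorem lt_getLast_primeLadder :
    436273009 < (2 :: primeLadder).getLast (List.cons_ne_nil 2 primeLadder) := by
  decide +kernel

theorem gap_lt_numerical_bound (p q : ℕ) (hp : p.Prime) (hle : p ≤ 436273009)
    (hq : q.Prime) (hpq : p < q) (hnext : ∀ r, r.Prime → p < r → q ≤ r) :
    ((q : ℝ) - p) < ((p : ℝ) + 1) / Real.log p := by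
  rw [lt_div_iff₀ (Real.log_pos (by exact_mod_cast hp.one_lt))]
  exact sub_mul_log_lt_of_isChain isChain_primeLadder two_pos
    (fun r hr => prime_of_mem_primeLadder hr) hp.two_le (hle.trans_lt lt_getLast_primeLadder) hnext
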